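/- Assume additionally p > 0 and set M̃ := (M_∞/m_∞)·(p̄/p). Let a > 0 be a real and q ∈ (0,1] be such that k := q·n is a positive integer. If q ≥ M̃/(M̃+a), then app(k) ≤ (1+a)·opt(k), i.e. Algorithm 1 returns a solution with multiplicative approximation guarantee at most a for k = q·n. -/

import Mathlib

open scoped BigOperators

/-- Dot product of two vectors in `ℝ^ν`. -/
noncomputable def dot {ν : ℕ} (c x : Fin ν → ℝ) : ℝ := ∑ j, c j * x j

/-- `convComb X k` is the set `X(k)` of all convex combinations of at most `k` points of `X`. -/
def convComb {ν : ℕ} (X : Set (Fin ν → ℝ)) (k : ℕ) : Set (Fin ν → ℝ) :=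
  { x | ∃ (xs : Fin k → (Fin ν → ℝ)) (lam : Fin k → ℝ),
      (∀ i, xs i ∈ X) ∧ (∀ i, 0 ≤ lam i) ∧ (∑ i, lam i) = 1 ∧
      x = ∑ i, lam i • xs i }

/-- The worst-case objective `max_{c ∈ U} cᵀx`. -/
noncomputable def objSup {ν : ℕ} (U : Set (Fin ν → ℝ)) (x : Fin ν → ℝ) : ℝ :=
  sSup ((fun c => dot c x) '' U)

/-- `opt(k) = min_{x ∈ X(k)} max_{c ∈ U} cᵀx`. -/
noncomputable def optVal {ν : ℕ} (X U : Set (Fin ν → ℝ)) (k : ℕ) : ℝ :=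
  sInf (objSup U '' convComb X k)

/-- `‖x‖₀`, the number of nonzero entries of `x`, as a real number. -/
noncomputable def zeroNorm {ν : ℕ} (x : Fin ν → ℝ) : ℝ :=
  ((Finset.univ.filter (fun j => x j ≠ 0)).card : ℝ)

/-- The min-max-min robust value over `k`-tuples of feasible solutions:
`min_{x¹,…,x^k ∈ X} max_{c ∈ U} min_{i} cᵀxⁱ`. -/
noncomputable def minmaxVal {ν : ℕ} (X U : Set (Fin ν → ℝ)) (k : ℕ) : ℝ :=
  sInf { v : ℝ | ∃ xs : Fin k → (Fin ν → ℝ), (∀ i, xs i ∈ X) ∧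
    v = sSup ((fun c => ⨅ i, dot c (xs i)) '' U) }

/-- `app(k)`, the objective value of the `k` solutions `x¹,…,x^k` with largest weights
returned by Algorithm 1: `max_{c ∈ U} min_{i=1,…,k} cᵀxⁱ`. -/
noncomputable def appVal {ν : ℕ} (U : Set (Fin ν → ℝ)) (xs : Fin ν → (Fin ν → ℝ)) (k : ℕ) : ℝ :=
  sSup ((fun c => ⨅ i : {i : Fin ν // (i : ℕ) < k}, dot c (xs i.1)) '' U)

/-- The dot product is linear in its second argument along finite sums. -/
lemma dot_sum_smul {ν : ℕ} {ι : Type*} [Fintype ι] (c : Fin ν → ℝ)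
    (w : ι → ℝ) (y : ι → Fin ν → ℝ) :
    dot c (∑ i, w i • y i) = ∑ i, w i * dot c (y i) := by
  simp only [dot, Finset.sum_apply, Pi.smul_apply, smul_eq_mul, Finset.mul_sum]
  rw [Finset.sum_comm]
  refine Finset.sum_congr rfl fun i _ => Finset.sum_congr rfl fun j _ => ?_
  ring

lemma dot_nonneg {ν : ℕ} {c x : Fin ν → ℝ} (hc : ∀ j, 0 ≤ c j) (hx : ∀ j, 0 ≤ x j) :
    0 ≤ dot c x :=
  Finset.sum_nonneg fun j _ => mul_nonneg (hc j) (hx j)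

lemma convComb_nonempty {ν : ℕ} {X : Set (Fin ν → ℝ)} (hX : X.Nonempty) {k : ℕ} (hk : 0 < k) :
    (convComb X k).Nonempty := by
  obtain ⟨x, hx⟩ := hX
  refine ⟨_, fun _ => x, Pi.single ⟨0, hk⟩ 1, fun _ => hx, fun i => ?_, by simp, rfl⟩
  exact (Pi.single_nonneg.2 zero_le_one : (0 : Fin k → ℝ) ≤ Pi.single ⟨0, hk⟩ 1) i

lemma convComb_mono {ν : ℕ} {X : Set (Fin ν → ℝ)} (hX : X.Nonempty) {k l : ℕ} (hkl : k ≤ l) :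
    convComb X k ⊆ convComb X l := by
  obtain ⟨d, rfl⟩ := Nat.exists_eq_add_of_le hkl
  obtain ⟨x₀, hx₀⟩ := hX
  rintro _ ⟨y, w, hy, hw, hsum, rfl⟩
  refine ⟨Fin.append y fun _ => x₀, Fin.append w fun _ => 0, fun i => ?_, fun i => ?_, ?_, ?_⟩
  · refine Fin.addCases (fun i => ?_) (fun i => ?_) i
    · simpa using hy i
    · simpa using hx₀
  · refine Fin.addCases (fun i => ?_) (fun i => ?_) i
    · simpa using hw i
    · simp
  · simp [Fin.sum_univ_add, hsum]
  · simp [Fin.sum_univ_add]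

lemma objSup_nonneg {ν : ℕ} {U : Set (Fin ν → ℝ)} (hU : ∀ c ∈ U, ∀ j, 0 ≤ c j)
    {x : Fin ν → ℝ} (hx : ∀ j, 0 ≤ x j) : 0 ≤ objSup U x := by
  refine Real.sSup_nonneg ?_
  rintro _ ⟨c, hc, rfl⟩
  exact dot_nonneg (hU c hc) hx

lemma nonneg_of_mem_convComb {ν : ℕ} {X : Set (Fin ν → ℝ)} (hX : ∀ x ∈ X, ∀ j, 0 ≤ x j)
    {k : ℕ} {x : Fin ν → ℝ} (hx : x ∈ convComb X k) (j : Fin ν) : 0 ≤ x j := by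
  obtain ⟨y, w, hy, hw, -, rfl⟩ := hx
  simp only [Finset.sum_apply, Pi.smul_apply, smul_eq_mul]
  exact Finset.sum_nonneg fun i _ => mul_nonneg (hw i) (hX _ (hy i) j)

lemma dot_le_objSup {ν : ℕ} {U : Set (Fin ν → ℝ)} (hU : IsCompact U) {c : Fin ν → ℝ}
    (hc : c ∈ U) (x : Fin ν → ℝ) : dot c x ≤ objSup U x := by
  refine le_csSup (hU.image ?_).bddAbove ⟨c, hc, rfl⟩
  unfold dot
  fun_prop

section Nonneg

variable {ν : ℕ} {X U : Set (Fin ν → ℝ)}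

lemma optVal_nonneg (hX : ∀ x ∈ X, ∀ j, 0 ≤ x j) (hU : ∀ c ∈ U, ∀ j, 0 ≤ c j) (k : ℕ) :
    0 ≤ optVal X U k := by
  refine Real.sInf_nonneg ?_
  rintro _ ⟨x, hx, rfl⟩
  exact objSup_nonneg hU (nonneg_of_mem_convComb hX hx)

lemma optVal_anti (hXne : X.Nonempty) (hX : ∀ x ∈ X, ∀ j, 0 ≤ x j)
    (hU : ∀ c ∈ U, ∀ j, 0 ≤ c j) {k l : ℕ} (hk : 0 < k) (hkl : k ≤ l) :
    optVal X U l ≤ optVal X U k := by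
  refine csInf_le_csInf ⟨0, ?_⟩ ((convComb_nonempty hXne hk).image _)
    (Set.image_mono (convComb_mono hXne hkl))
  rintro _ ⟨x, hx, rfl⟩
  exact objSup_nonneg hU (nonneg_of_mem_convComb hX hx)

end Nonneg

/-- The `k` largest of `n` weights summing to one have total weight at least `k / n`. -/
lemma le_mul_sum_ite_of_antitone {n k : ℕ} (hkn : k ≤ n) {w : Fin n → ℝ} (hw : Antitone w)
    (hsum : ∑ i, w i = 1) :
    (k : ℝ) ≤ n * ∑ i : Fin n, if (i : ℕ) < k then w i else 0 := by
  have hind : Antitone fun i : Fin n => if (i : ℕ) < k then (1 : ℝ) else 0 := by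
    intro i j hij
    have : (i : ℕ) ≤ j := hij
    dsimp only
    split_ifs <;> first | omega | norm_num
  have hcard : (∑ i : Fin n, if (i : ℕ) < k then (1 : ℝ) else 0) = k := by
    rw [Finset.sum_boole, Fin.card_filter_val_lt, min_eq_right hkn]
  have := (hw.monovary hind).sum_mul_sum_le_card_mul_sum
  simpa [hsum, hcard] using this

/-- Dropping the lightest solutions costs at most the factor given by the retained weight. -/
lemma sum_ite_mul_iInf_le {n k : ℕ} {w d : Fin n → ℝ} (hw : ∀ i, 0 ≤ w i) (hd : ∀ i, 0 ≤ d i) :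
    (∑ i : Fin n, if (i : ℕ) < k then w i else 0) *
      (⨅ i : {i : Fin n // (i : ℕ) < k}, d i.1) ≤ ∑ i, w i * d i := by
  rw [Finset.sum_mul]
  refine Finset.sum_le_sum fun i _ => ?_
  split_ifs with h
  · exact mul_le_mul_of_nonneg_left
      (ciInf_le (f := fun i : {i : Fin n // (i : ℕ) < k} => d i.1)
        (Set.finite_range _).bddBelow ⟨i, h⟩) (hw i)
  · simpa using mul_nonneg (hw i) (hd i)

/-- Assume `p > 0` and set `M̃ = (M_∞/m_∞)·(p̄/p)`. Let `a > 0` and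
`q ∈ (0,1]` with `k = q·n` a positive integer. If `q ≥ M̃/(M̃+a)`, then
`app(k) ≤ (1+a)·opt(k)`. -/
theorem stmt11 (n : ℕ) (hn : 0 < n)
    (X : Set (Fin n → ℝ)) (hXfin : X.Finite) (hXne : X.Nonempty)
    (hXbin : ∀ x ∈ X, ∀ j, x j = 0 ∨ x j = 1)
    (U : Set (Fin n → ℝ)) (hUne : U.Nonempty) (hUcomp : IsCompact U) (hUconv : Convex ℝ U)
    (m_inf M_inf : ℝ) (hm : 0 < m_inf) (hmM : m_inf ≤ M_inf)
    (hc : ∀ c ∈ U, ∀ j, m_inf ≤ c j ∧ c j ≤ M_inf)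
    (p pbar : ℝ) (hp0 : 0 ≤ p) (hppbar : p ≤ pbar)
    (hpx : ∀ x ∈ X, p ≤ zeroNorm x ∧ zeroNorm x ≤ pbar)
    (xs : Fin n → (Fin n → ℝ)) (lam : Fin n → ℝ)
    (hxs : ∀ i, xs i ∈ X) (hlam0 : ∀ i, 0 ≤ lam i) (hlamsum : (∑ i, lam i) = 1)
    (hlamsort : ∀ i j : Fin n, i ≤ j → lam j ≤ lam i)
    (hopt : objSup U (∑ i, lam i • xs i) = optVal X U n)
    (hppos : 0 < p)
    (a : ℝ) (ha : 0 < a) (q : ℝ) (hq0 : 0 < q) (hq1 : q ≤ 1)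
    (k : ℕ) (hkpos : 0 < k) (hkq : (k : ℝ) = q * (n : ℝ))
    (hqbound : (M_inf / m_inf) * (pbar / p) / ((M_inf / m_inf) * (pbar / p) + a) ≤ q) :
    appVal U xs k ≤ (1 + a) * optVal X U k := by
  have hX0 : ∀ x ∈ X, ∀ j, 0 ≤ x j := fun x hx j => by
    rcases hXbin x hx j with h | h <;> simp [h]
  have hU0 : ∀ c ∈ U, ∀ j, 0 ≤ c j := fun c hcU j => hm.le.trans (hc c hcU j).1
  have hn' : (0 : ℝ) < n := Nat.cast_pos.2 hn
  have hkn : k ≤ n := by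
    have : (k : ℝ) ≤ n := by nlinarith
    exact_mod_cast this
  have hM1 : 1 ≤ (M_inf / m_inf) * (pbar / p) :=
    one_le_mul_of_one_le_of_one_le ((one_le_div hm).2 hmM) ((one_le_div hppos).2 hppbar)
  have hqa : 1 ≤ (1 + a) * q := by
    rw [div_le_iff₀ (by linarith)] at hqbound
    nlinarith [mul_nonneg (sub_nonneg.2 hq1) (sub_nonneg.2 hM1)]
  have hweight := le_mul_sum_ite_of_antitone hkn (fun i j h => hlamsort i j h) hlamsum
  have hq : q ≤ ∑ i : Fin n, if (i : ℕ) < k then lam i else 0 := by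
    rw [hkq, mul_comm] at hweight
    exact le_of_mul_le_mul_left hweight hn'
  have hbound : appVal U xs k ≤ (1 + a) * optVal X U n := by
    refine csSup_le (hUne.image _) ?_
    rintro _ ⟨c, hcU, rfl⟩
    have hd : ∀ i, 0 ≤ dot c (xs i) := fun i => dot_nonneg (hU0 c hcU) (hX0 _ (hxs i))
    have hle := sum_ite_mul_iInf_le (k := k) hlam0 hd
    rw [← dot_sum_smul] at hle
    have hmin : 0 ≤ ⨅ i : {i : Fin n // (i : ℕ) < k}, dot c (xs i.1) :=
      Real.iInf_nonneg fun i => hd i.1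
    have hobj := dot_le_objSup hUcomp hcU (∑ i, lam i • xs i)
    rw [hopt] at hobj
    calc (⨅ i : {i : Fin n // (i : ℕ) < k}, dot c (xs i.1))
        ≤ (1 + a) * q * ⨅ i : {i : Fin n // (i : ℕ) < k}, dot c (xs i.1) :=
          le_mul_of_one_le_left hmin hqa
      _ = (1 + a) * (q * ⨅ i : {i : Fin n // (i : ℕ) < k}, dot c (xs i.1)) := mul_assoc _ _ _
      _ ≤ (1 + a) * optVal X U n := mul_le_mul_of_nonneg_left
          ((mul_le_mul_of_nonneg_right hq hmin).trans (hle.trans hobj)) (by linarith)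
  exact hbound.trans
    (mul_le_mul_of_nonneg_left (optVal_anti hXne hX0 hU0 hkpos hkn) (by linarith))
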